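/- Setting v₁ := X₀ − i𝒥₁X₀ − (𝒥₃X₀ + i𝒥₂X₀) and v_i := X₀ − i𝒥₁X₀ + 𝒥₃X₀ + i𝒥₂X₀ in W_ℂ, one has the direct sum decompositions L₁ ∩ L₂ = ℂ·v₁ ⊕ (L₁ ∩ L₂ ∩ S_ℂ^⊥) and L₁ ∩ conj(L₂) = ℂ·v_i ⊕ (L₁ ∩ conj(L₂) ∩ S_ℂ^⊥). -/

import Mathlib

open Module TensorProduct

/-- The generalized tangent space `W = V ⊕ V*`. -/
abbrev GT (V : Type*) [AddCommGroup V] [Module ℝ V] := V × Module.Dual ℝ V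

/-- The canonical symmetric pairing `⟨X+ξ, Y+η⟩ = (1/2)(η(X) + ξ(Y))` on `W = V ⊕ V*`,
as a bilinear form. -/
noncomputable def gpairB (V : Type*) [AddCommGroup V] [Module ℝ V] :
    LinearMap.BilinForm ℝ (GT V) :=
  (1 / 2 : ℝ) •
    ((LinearMap.id : Module.Dual ℝ V →ₗ[ℝ] Module.Dual ℝ V).compl₁₂
        (LinearMap.snd ℝ V (Module.Dual ℝ V)) (LinearMap.fst ℝ V (Module.Dual ℝ V)) +
      ((LinearMap.id : Module.Dual ℝ V →ₗ[ℝ] Module.Dual ℝ V).compl₁₂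
        (LinearMap.snd ℝ V (Module.Dual ℝ V)) (LinearMap.fst ℝ V (Module.Dual ℝ V))).flip)

/-- A generalized almost complex structure on `V`. -/
def IsGacs {V : Type*} [AddCommGroup V] [Module ℝ V] (J : GT V →ₗ[ℝ] GT V) : Prop :=
  (∀ u, J (J u) = -u) ∧ (∀ u v, gpairB V (J u) v = - gpairB V u (J v))

/-- A generalized almost Hermitian structure on `V`. -/
structure IsGah {V : Type*} [AddCommGroup V] [Module ℝ V]
    (G : GT V →ₗ[ℝ] GT V →ₗ[ℝ] ℝ) (J Gend : GT V →ₗ[ℝ] GT V) : Prop where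
  gacs : IsGacs J
  symm : ∀ u v, G u v = G v u
  posdef : ∀ u, u ≠ 0 → 0 < G u u
  hermitian : ∀ u v, G (J u) (J v) = G u v
  gend_pair : ∀ u v, G u v = gpairB V (Gend u) v
  gend_sq : ∀ u, Gend (Gend u) = u

instance : RingHomSurjective (starRingEnd ℂ) := ⟨fun x => ⟨star x, by simp⟩⟩

/-- Complex conjugation on the complexification `ℂ ⊗ M` of a real module. -/
noncomputable def conjC (M : Type*) [AddCommGroup M] [Module ℝ M] :
    (ℂ ⊗[ℝ] M) →ₛₗ[starRingEnd ℂ] (ℂ ⊗[ℝ] M) where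
  toFun := LinearMap.rTensor M Complex.conjAe.toLinearMap
  map_add' x y := map_add _ x y
  map_smul' c x := by
    show LinearMap.rTensor M Complex.conjAe.toLinearMap (c • x) =
      (starRingEnd ℂ) c • LinearMap.rTensor M Complex.conjAe.toLinearMap x
    induction x using TensorProduct.induction_on with
    | zero => simp
    | tmul a m =>
        rw [smul_tmul', LinearMap.rTensor_tmul, LinearMap.rTensor_tmul, smul_tmul']
        congr 1
        simp [Complex.conjAe]
    | add x y hx hy =>
        rw [smul_add, map_add, hx, hy, map_add, smul_add]

/-- The `(1,0)`-space (`i`-eigenspace) of the complexification of an endomorphism of `W`. -/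
noncomputable def iEigen {V : Type*} [AddCommGroup V] [Module ℝ V]
    (J : GT V →ₗ[ℝ] GT V) : Submodule ℂ (ℂ ⊗[ℝ] GT V) :=
  @Module.End.eigenspace ℂ (ℂ ⊗[ℝ] GT V) _ _ _ (J.baseChange ℂ) Complex.I

/-- The projection `pr_T : W_ℂ → V_ℂ`. -/
noncomputable def prTc (V : Type*) [AddCommGroup V] [Module ℝ V] :
    (ℂ ⊗[ℝ] GT V) →ₗ[ℂ] ℂ ⊗[ℝ] V :=
  (LinearMap.fst ℝ V (Module.Dual ℝ V)).baseChange ℂ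

section Pairing

variable {V : Type*} [AddCommGroup V] [Module ℝ V]

theorem gpairB_apply (u v : GT V) : gpairB V u v = (1 / 2 : ℝ) * (u.2 v.1 + v.2 u.1) := by
  simp [gpairB, mul_add]

theorem gpairB_comm (u v : GT V) : gpairB V u v = gpairB V v u := by
  simp only [gpairB_apply, add_comm]

namespace IsGah

variable {G : GT V →ₗ[ℝ] GT V →ₗ[ℝ] ℝ} {J Gend : GT V →ₗ[ℝ] GT V}

theorem gend_symm (h : IsGah G J Gend) (u v : GT V) :
    gpairB V (Gend u) v = gpairB V u (Gend v) := by
  rw [← h.gend_pair, h.symm, h.gend_pair, gpairB_comm]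

theorem eq_zero_of_gpairB (h : IsGah G J Gend) {w : GT V} (hw : ∀ v, gpairB V w v = 0) :
    w = 0 := by
  have hG : Gend w = 0 := by
    by_contra hne
    have hpos := h.posdef _ hne
    rw [h.gend_pair, h.gend_sq, hw] at hpos
    exact lt_irrefl _ hpos
  rw [← h.gend_sq w, hG, map_zero]

theorem gend_comm (h : IsGah G J Gend) (u : GT V) : Gend (J u) = J (Gend u) := by
  have key : J (Gend (J u)) + Gend u = 0 := h.eq_zero_of_gpairB fun v => by
    have h1 := h.hermitian u v
    rw [h.gend_pair, h.gend_pair] at h1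
    have h2 := h.gacs.2 (Gend (J u)) v
    rw [map_add, LinearMap.add_apply]
    linarith
  have h3 := congrArg J key
  rw [map_add, h.gacs.1, map_zero] at h3
  exact neg_add_eq_zero.mp h3

theorem gpairB_J_self (h : IsGah G J Gend) (u : GT V) : gpairB V u (J u) = 0 := by
  have h1 := h.gacs.2 u u
  rw [gpairB_comm] at h1
  linarith

theorem gpairB_gend_J_self (h : IsGah G J Gend) (u : GT V) :
    gpairB V u (Gend (J u)) = 0 := by
  have h1 := h.gacs.2 u (Gend u)
  rw [← h.gend_symm, ← h.gend_comm, h.gend_symm, h.gend_comm, ← h.gend_comm, gpairB_comm,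
    h.gend_symm] at h1
  linarith

end IsGah

end Pairing

section Complexification

variable {M : Type*} [AddCommGroup M] [Module ℝ M]

theorem conjC_tmul (c : ℂ) (m : M) :
    conjC M (c ⊗ₜ[ℝ] m) = (starRingEnd ℂ c) ⊗ₜ[ℝ] m := rfl

theorem conjC_conjC (x : ℂ ⊗[ℝ] M) : conjC M (conjC M x) = x := by
  induction x using TensorProduct.induction_on with
  | zero => simp
  | tmul a m => simp [conjC_tmul]
  | add x y hx hy => rw [map_add, map_add, hx, hy]

theorem baseChange_conjC (J : M →ₗ[ℝ] M) (x : ℂ ⊗[ℝ] M) :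
    J.baseChange ℂ (conjC M x) = conjC M (J.baseChange ℂ x) := by
  induction x using TensorProduct.induction_on with
  | zero => simp
  | tmul a m => simp [conjC_tmul]
  | add x y hx hy => simp only [map_add, hx, hy]

theorem baseChange_form_tmul_right (B : LinearMap.BilinForm ℝ M) {f g : M →ₗ[ℝ] M} {m : M}
    (hfg : ∀ n, B (f m) n = B m (g n)) (x : ℂ ⊗[ℝ] M) :
    B.baseChange ℂ ((1 : ℂ) ⊗ₜ[ℝ] f m) x =
      B.baseChange ℂ ((1 : ℂ) ⊗ₜ[ℝ] m) (g.baseChange ℂ x) := by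
  induction x using TensorProduct.induction_on with
  | zero => simp
  | tmul a n => simp [hfg]
  | add x y hx hy => simp only [map_add, hx, hy]

variable {V : Type*} [AddCommGroup V] [Module ℝ V]

theorem mem_iEigen {J : GT V →ₗ[ℝ] GT V} {x : ℂ ⊗[ℝ] GT V} :
    x ∈ iEigen J ↔ J.baseChange ℂ x = Complex.I • x :=
  Module.End.mem_eigenspace_iff

theorem mem_map_conjC_iEigen {J : GT V →ₗ[ℝ] GT V} {x : ℂ ⊗[ℝ] GT V} :
    x ∈ (iEigen J).map (conjC (GT V)) ↔ J.baseChange ℂ x = -(Complex.I • x) := by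
  constructor
  · rintro ⟨y, hy, rfl⟩
    rw [baseChange_conjC, mem_iEigen.mp hy, LinearMap.map_smulₛₗ, Complex.conj_I, neg_smul]
  · intro hx
    refine ⟨conjC _ x, mem_iEigen.mpr ?_, conjC_conjC x⟩
    rw [baseChange_conjC, hx, map_neg, LinearMap.map_smulₛₗ, Complex.conj_I, neg_smul, neg_neg]

end Complexification

/-- If membership in `P` is cut out on `A` by a functional `φ` not vanishing on `v ∈ A`, then
`A = K v ⊕ (A ⊓ P)`. -/
theorem eq_span_singleton_sup_inf {K E : Type*} [Field K] [AddCommGroup E] [Module K E]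
    {A P : Submodule K E} {v : E} (φ : E →ₗ[K] K) (hv : v ∈ A) (hφ : φ v ≠ 0)
    (hP : ∀ x ∈ A, x ∈ P ↔ φ x = 0) :
    A = (K ∙ v) ⊔ (A ⊓ P) ∧ (K ∙ v) ⊓ (A ⊓ P) = ⊥ := by
  constructor
  · refine le_antisymm (fun x hx => ?_)
      (sup_le ((Submodule.span_singleton_le_iff_mem _ _).mpr hv) inf_le_left)
    have hy : x - (φ x / φ v) • v ∈ A := A.sub_mem hx (A.smul_mem _ hv)
    refine Submodule.mem_sup.mpr ⟨(φ x / φ v) • v,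
      Submodule.smul_mem _ _ (Submodule.mem_span_singleton_self v),
      x - (φ x / φ v) • v, ⟨hy, (hP _ hy).mpr ?_⟩, by abel⟩
    rw [map_sub, map_smul, smul_eq_mul, div_mul_cancel₀ _ hφ, sub_self]
  · rw [eq_bot_iff]
    rintro x ⟨hx, hxA, hxP⟩
    obtain ⟨c, rfl⟩ := Submodule.mem_span_singleton.mp hx
    have h0 := (hP _ hxA).mp hxP
    rw [map_smul, smul_eq_mul, mul_eq_zero, or_iff_left hφ] at h0
    simp [h0]

namespace IsGah

variable {V : Type*} [AddCommGroup V] [Module ℝ V]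
  {G : GT V →ₗ[ℝ] GT V →ₗ[ℝ] ℝ} {J Gend : GT V →ₗ[ℝ] GT V}

/-- On `i`-eigenvectors of `J` that are also eigenvectors of `Gend ∘ J`, orthogonality to the
complexified span of `e, J e, Gend (J e), J (Gend (J e))` reduces to orthogonality to `e`. -/
theorem mem_orthogonal_iff (h : IsGah G J Gend) (e : GT V) {x : ℂ ⊗[ℝ] GT V} {c : ℂ}
    (hJ : J.baseChange ℂ x = Complex.I • x)
    (hJ₂ : (Gend ∘ₗ J).baseChange ℂ x = c • x) :
    x ∈ ((gpairB V).baseChange ℂ).orthogonal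
        ((Submodule.span ℝ {e, J e, (Gend ∘ₗ J) e, (J ∘ₗ Gend ∘ₗ J) e}).baseChange ℂ) ↔
      (gpairB V).baseChange ℂ ((1 : ℂ) ⊗ₜ[ℝ] e) x = 0 := by
  rw [LinearMap.BilinForm.mem_orthogonal_iff]
  constructor
  · intro hx
    exact hx _ (Submodule.tmul_mem_baseChange_of_mem _ (Submodule.subset_span (by simp)))
  · intro h0
    have hJ' (m : GT V) : (gpairB V).baseChange ℂ ((1 : ℂ) ⊗ₜ[ℝ] J m) x =
        -(Complex.I * (gpairB V).baseChange ℂ ((1 : ℂ) ⊗ₜ[ℝ] m) x) := by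
      rw [baseChange_form_tmul_right (g := -J) _ (fun n => by simpa using h.gacs.2 m n),
        LinearMap.baseChange_neg, LinearMap.neg_apply, hJ, map_neg, map_smul, smul_eq_mul]
    have hJ₂' (m : GT V) : (gpairB V).baseChange ℂ ((1 : ℂ) ⊗ₜ[ℝ] (Gend ∘ₗ J) m) x =
        -(c * (gpairB V).baseChange ℂ ((1 : ℂ) ⊗ₜ[ℝ] m) x) := by
      rw [baseChange_form_tmul_right (g := -(Gend ∘ₗ J)) _
        (fun n => by simp [h.gend_symm, h.gacs.2, h.gend_comm]),
        LinearMap.baseChange_neg, LinearMap.neg_apply, hJ₂, map_neg, map_smul, smul_eq_mul]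
    have hspan : ∀ s ∈ Submodule.span ℝ {e, J e, (Gend ∘ₗ J) e, (J ∘ₗ Gend ∘ₗ J) e},
        (gpairB V).baseChange ℂ ((1 : ℂ) ⊗ₜ[ℝ] s) x = 0 := by
      intro s hs
      induction hs using Submodule.span_induction with
      | mem s hs =>
        rcases hs with rfl | rfl | rfl | rfl
        · exact h0
        · rw [hJ', h0, mul_zero, neg_zero]
        · rw [hJ₂', h0, mul_zero, neg_zero]
        · rw [LinearMap.comp_apply, hJ', hJ₂', h0, mul_zero, neg_zero, mul_zero, neg_zero]
      | zero => simp
      | add s t _ _ hs ht => rw [tmul_add, map_add, LinearMap.add_apply, hs, ht, add_zero]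
      | smul a s _ hs =>
        have hsmul : (1 : ℂ) ⊗ₜ[ℝ] (a • s) = (a : ℂ) • ((1 : ℂ) ⊗ₜ[ℝ] s) := by
          rw [← smul_tmul, smul_tmul', Complex.real_smul, smul_eq_mul]
        rw [hsmul, map_smul, LinearMap.smul_apply, hs, smul_zero]
    intro n hn
    rw [Submodule.baseChange_eq_span] at hn
    change (gpairB V).baseChange ℂ n x = 0
    induction hn using Submodule.span_induction with
    | mem n hn =>
      obtain ⟨s, hs, rfl⟩ := hn
      exact hspan s hs
    | zero => simp
    | add s t _ _ hs ht => rw [map_add, LinearMap.add_apply, hs, ht, add_zero]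
    | smul a s _ hs => rw [map_smul, LinearMap.smul_apply, hs, smul_zero]

end IsGah

/-- with `v₁ = X₀ − i𝒥₁X₀ − (𝒥₃X₀ + i𝒥₂X₀)` and
`v_i = X₀ − i𝒥₁X₀ + 𝒥₃X₀ + i𝒥₂X₀` in `W_ℂ`, one has the direct sum decompositions
`L₁ ⊓ L₂ = ℂ·v₁ ⊕ (L₁ ⊓ L₂ ⊓ S_ℂ^⊥)` and
`L₁ ⊓ conj(L₂) = ℂ·v_i ⊕ (L₁ ⊓ conj(L₂) ⊓ S_ℂ^⊥)`. -/
theorem statement15 {V : Type*} [AddCommGroup V] [Module ℝ V] [FiniteDimensional ℝ V]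
    (G : GT V →ₗ[ℝ] GT V →ₗ[ℝ] ℝ) (J Gend : GT V →ₗ[ℝ] GT V)
    (hGah : IsGah G J Gend) (X₀ : V) (hX₀ : X₀ ≠ 0) :
    letI e : GT V := (X₀, 0)
    letI J₂ : GT V →ₗ[ℝ] GT V := Gend ∘ₗ J
    letI J₃ : GT V →ₗ[ℝ] GT V := J ∘ₗ Gend ∘ₗ J
    letI S : Submodule ℝ (GT V) := Submodule.span ℝ {e, J e, J₂ e, J₃ e}
    letI L₁ := iEigen J
    letI L₂ := iEigen J₂
    letI Scperp := ((gpairB V).baseChange ℂ).orthogonal (S.baseChange ℂ)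
    letI ι : GT V → ℂ ⊗[ℝ] GT V := fun w => (1 : ℂ) ⊗ₜ[ℝ] w
    letI v₁ : ℂ ⊗[ℝ] GT V := ι e - Complex.I • ι (J e)
      - (ι (J₃ e) + Complex.I • ι (J₂ e))
    letI vi : ℂ ⊗[ℝ] GT V := ι e - Complex.I • ι (J e)
      + (ι (J₃ e) + Complex.I • ι (J₂ e))
    (L₁ ⊓ L₂ = (ℂ ∙ v₁) ⊔ (L₁ ⊓ L₂ ⊓ Scperp) ∧
      (ℂ ∙ v₁) ⊓ (L₁ ⊓ L₂ ⊓ Scperp) = ⊥) ∧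
    (L₁ ⊓ L₂.map (conjC (GT V)) =
        (ℂ ∙ vi) ⊔ (L₁ ⊓ L₂.map (conjC (GT V)) ⊓ Scperp) ∧
      (ℂ ∙ vi) ⊓ (L₁ ⊓ L₂.map (conjC (GT V)) ⊓ Scperp) = ⊥) := by
  let e : GT V := (X₀, 0)
  let J₂ : GT V →ₗ[ℝ] GT V := Gend ∘ₗ J
  let J₃ : GT V →ₗ[ℝ] GT V := J ∘ₗ Gend ∘ₗ J
  let ι : GT V → ℂ ⊗[ℝ] GT V := fun w => (1 : ℂ) ⊗ₜ[ℝ] w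
  let v₁ : ℂ ⊗[ℝ] GT V := ι e - Complex.I • ι (J e) - (ι (J₃ e) + Complex.I • ι (J₂ e))
  let vi : ℂ ⊗[ℝ] GT V := ι e - Complex.I • ι (J e) + (ι (J₃ e) + Complex.I • ι (J₂ e))
  have he : e ≠ 0 := fun h => hX₀ (congrArg Prod.fst h)
  have hee : gpairB V e e = 0 := by simp [gpairB_apply, e]
  have hGe : (gpairB V e (Gend e) : ℂ) ≠ 0 := by
    rw [← hGah.gend_symm, ← hGah.gend_pair]
    exact_mod_cast (hGah.posdef e he).ne'
  have hJ₃ : J₃ e = -Gend e := by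
    simp only [J₃, LinearMap.comp_apply, hGah.gend_comm, hGah.gacs.1]
  have hJι (f : GT V →ₗ[ℝ] GT V) (w : GT V) : f.baseChange ℂ (ι w) = ι (f w) := rfl
  have hιneg (w : GT V) : ι (-w) = -ι w := tmul_neg _ _
  have hB (u w : GT V) : (gpairB V).baseChange ℂ (ι u) (ι w) = (gpairB V u w : ℂ) := by
    simp [ι]
  have hI (x : ℂ ⊗[ℝ] GT V) : Complex.I • Complex.I • x = -x := by
    rw [smul_smul, Complex.I_mul_I, neg_one_smul]
  have hJ₂e : J₂ e = Gend (J e) := rfl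
  have hJJ₂ : J (J₂ e) = -Gend e := hJ₃
  have hJG : J (Gend e) = J₂ e := (hGah.gend_comm e).symm
  have hJ₂J : J₂ (J e) = -Gend e := by simp [J₂, hGah.gacs.1]
  have hJ₂J₂ : J₂ (J₂ e) = -e := by
    simp [J₂, ← hGah.gend_comm, hGah.gacs.1, hGah.gend_sq]
  have hJ₂G : J₂ (Gend e) = J e := by
    simp [J₂, ← hGah.gend_comm, hGah.gend_sq]
  constructor
  · refine eq_span_singleton_sup_inf (v := v₁) ((gpairB V).baseChange ℂ (ι e))
      ⟨mem_iEigen.mpr ?_,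
      mem_iEigen.mpr ?_⟩ ?_
      fun x hx => hGah.mem_orthogonal_iff e (mem_iEigen.mp hx.1) (mem_iEigen.mp hx.2)
    · simp only [v₁, hJ₃, map_sub, map_add, map_smul, hJι, hιneg, hGah.gacs.1, hJJ₂, hJG,
        smul_sub, smul_add, smul_neg, hI, map_neg]
      abel
    · change J₂.baseChange ℂ v₁ = Complex.I • v₁
      simp only [v₁, hJ₃, map_sub, map_add, map_smul, hJι, hιneg, hJ₂J, hJ₂J₂, hJ₂G,
        smul_sub, smul_add, smul_neg, hI, map_neg]
      abel
    · simpa [v₁, hJ₃, hιneg, hB, hee, hGah.gpairB_J_self, hJ₂e, hGah.gpairB_gend_J_self]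
        using hGe
  · refine eq_span_singleton_sup_inf (v := vi) ((gpairB V).baseChange ℂ (ι e))
      ⟨mem_iEigen.mpr ?_,
      mem_map_conjC_iEigen.mpr ?_⟩ ?_
      fun x hx => hGah.mem_orthogonal_iff e (mem_iEigen.mp hx.1) (c := -Complex.I)
        ((mem_map_conjC_iEigen.mp hx.2).trans (neg_smul _ _).symm)
    · simp only [vi, hJ₃, map_sub, map_add, map_smul, hJι, hιneg, hGah.gacs.1, hJJ₂, hJG,
        smul_sub, smul_add, smul_neg, hI, map_neg]
      abel
    · change J₂.baseChange ℂ vi = -(Complex.I • vi)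
      simp only [vi, hJ₃, map_sub, map_add, map_smul, hJι, hιneg, hJ₂J, hJ₂J₂, hJ₂G,
        smul_sub, smul_add, smul_neg, hI, map_neg]
      abel
    · simpa [vi, hJ₃, hιneg, hB, hee, hGah.gpairB_J_self, hJ₂e, hGah.gpairB_gend_J_self]
        using hGe
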